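/- Let θ ∈ (0,1), let β be a nonnegative integer and m = 2^β, and let δ = ρ/(2τ) where ρ, τ are positive integers with ρ ≤ τ. Then the contribution of the negative residuals to the average code-length satisfies ∫_{−∞}^{0} ℓ(ε)·f_θ(ε) dε = (1/2)(1 + β) + (1/2)·(θ^(m/2)/(1 − θ^(m/2)))·θ^δ. -/

import Mathlib

open MeasureTheory

lemma setIntegral_Ioi_eq_comp_add_right (f : ℝ → ℝ) (c : ℝ) :
    ∫ t in Set.Ioi c, f t = ∫ s in Set.Ioi (0:ℝ), f (s + c) := by
  have h := (measurePreserving_add_right (volume : Measure ℝ) c).setIntegral_preimage_emb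
    (measurableEmbedding_addRight c) f (Set.Ioi c)
  rw [← h, Set.preimage_add_const_Ioi, sub_self]

lemma integrableOn_floor_abs_sub_mul_exp {a c : ℝ} (ha : 0 < a) (hc : 0 < c) (δ : ℝ) :
    IntegrableOn (fun t : ℝ => (⌊|t - δ| / c⌋ : ℝ) * Real.exp (-a * t)) (Set.Ioi 0) := by
  have h_exp : IntegrableOn (fun t : ℝ => Real.exp (-a * t)) (Set.Ioi 0) :=
    integrableOn_exp_mul_Ioi (neg_lt_zero.2 ha) 0
  have h_lin : IntegrableOn (fun t : ℝ => t * Real.exp (-a * t)) (Set.Ioi 0) := by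
    simpa using integrableOn_rpow_mul_exp_neg_mul_rpow (p := 1) (s := 1) (b := a)
      (by norm_num) one_pos ha
  refine Integrable.mono' ((h_lin.add (h_exp.const_mul |δ|)).const_mul c⁻¹)
    (Measurable.aestronglyMeasurable (by fun_prop)) ?_
  filter_upwards [ae_restrict_mem measurableSet_Ioi] with t ht
  have ht0 : 0 < t := ht
  have h_floor : (0 : ℝ) ≤ (⌊|t - δ| / c⌋ : ℝ) := by
    exact_mod_cast Int.floor_nonneg.2 (by positivity)
  have h_abs : |t - δ| ≤ t + |δ| := by
    simpa [abs_of_pos ht0] using abs_sub t δ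
  rw [Real.norm_of_nonneg (mul_nonneg h_floor (Real.exp_pos _).le)]
  calc (⌊|t - δ| / c⌋ : ℝ) * Real.exp (-a * t)
      ≤ ((t + |δ|) / c) * Real.exp (-a * t) := by
        gcongr
        exact (Int.floor_le _).trans (by gcongr)
    _ = _ := by simp only [Pi.add_apply]; ring

/-- If the integrand vanishes on `(0, c)`, its integral over `(0, ∞)` can be shifted by `c`. -/
lemma setIntegral_Ioi_zero_eq_shift {f : ℝ → ℝ} {c : ℝ} (hc : 0 ≤ c)
    (hf : ∀ t, 0 < t → t < c → f t = 0) :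
    ∫ t in Set.Ioi (0:ℝ), f t = ∫ s in Set.Ioi (0:ℝ), f (s + c) := by
  rw [← setIntegral_Ioi_eq_comp_add_right, ← integral_Ici_eq_integral_Ioi (x := c)]
  rcases hc.eq_or_lt with rfl | hc
  · rw [integral_Ici_eq_integral_Ioi]
  exact setIntegral_eq_of_subset_of_forall_sdiff_eq_zero measurableSet_Ioi
    (Set.Ici_subset_Ioi.2 hc) fun t ht => hf t ht.1 (not_le.1 ht.2)

lemma setIntegral_floor_mul_exp {a c : ℝ} (ha : 0 < a) (hc : 0 < c) :
    ∫ t in Set.Ioi (0:ℝ), (⌊t / c⌋ : ℝ) * Real.exp (-a * t)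
      = Real.exp (-a * c) / (1 - Real.exp (-a * c)) / a := by
  have h_exp : IntegrableOn (fun t : ℝ => Real.exp (-a * t)) (Set.Ioi 0) :=
    integrableOn_exp_mul_Ioi (neg_lt_zero.2 ha) 0
  have h_int : IntegrableOn (fun t : ℝ => (⌊t / c⌋ : ℝ) * Real.exp (-a * t)) (Set.Ioi 0) := by
    refine (integrableOn_floor_abs_sub_mul_exp ha hc 0).congr_fun (fun t ht => ?_)
      measurableSet_Ioi
    simp only [sub_zero, abs_of_pos (Set.mem_Ioi.1 ht)]
  have h_rec : ∫ t in Set.Ioi (0:ℝ), (⌊t / c⌋ : ℝ) * Real.exp (-a * t)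
      = Real.exp (-a * c) *
        ((∫ t in Set.Ioi (0:ℝ), (⌊t / c⌋ : ℝ) * Real.exp (-a * t)) + 1 / a) := by
    have h_one : ∫ t in Set.Ioi (0:ℝ), Real.exp (-a * t) = 1 / a := by
      rw [integral_exp_mul_Ioi (neg_lt_zero.2 ha)]; simp [neg_div_neg_eq]
    rw [← h_one, ← integral_add h_int h_exp, ← integral_const_mul,
      setIntegral_Ioi_zero_eq_shift hc.le]
    · congr 1 with s
      rw [add_div, div_self hc.ne', Int.floor_add_one, mul_add, Real.exp_add]
      push_cast
      ring
    · intro t ht htc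
      rw [Int.floor_eq_zero_iff.2 ⟨by positivity, (div_lt_one hc).2 htc⟩]
      simp
  have hq : Real.exp (-a * c) < 1 := by
    rw [Real.exp_lt_one_iff]; nlinarith [mul_pos ha hc]
  have hq' : 1 - Real.exp (-a * c) ≠ 0 := by linarith
  rw [div_div, eq_div_iff (mul_ne_zero hq' ha.ne')]
  linear_combination a * h_rec + Real.exp (-a * c) * mul_one_div_cancel ha.ne'

lemma setIntegral_floor_abs_sub_mul_exp {a c δ : ℝ} (ha : 0 < a) (hc : 0 < c)
    (hδ : 0 ≤ δ) (hδc : δ ≤ c) :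
    ∫ t in Set.Ioi (0:ℝ), (⌊|t - δ| / c⌋ : ℝ) * Real.exp (-a * t)
      = Real.exp (-a * δ) * (Real.exp (-a * c) / (1 - Real.exp (-a * c)) / a) := by
  rw [← setIntegral_floor_mul_exp ha hc, ← integral_const_mul,
    setIntegral_Ioi_zero_eq_shift hδ]
  · refine setIntegral_congr_fun measurableSet_Ioi fun s hs => ?_
    simp only [add_sub_cancel_right, abs_of_pos (Set.mem_Ioi.1 hs), mul_add, Real.exp_add]
    ring
  · intro t ht htδ
    have h_lt : |t - δ| < c := by rw [abs_lt]; constructor <;> linarith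
    rw [Int.floor_eq_zero_iff.2 ⟨by positivity, (div_lt_one hc).2 h_lt⟩]
    simp

/-- contribution of the negative residuals to the average code-length
when `m = 2^β`. -/
theorem neg_side_pow_two (θ : ℝ) (hθ : θ ∈ Set.Ioo (0:ℝ) 1)
    (β : ℕ) (ρ τ : ℕ) (hρ : 0 < ρ) (hτ : 0 < τ) (hρτ : ρ ≤ τ)
    (m : ℕ) (hm : m = 2 ^ β) (δ : ℝ) (hδ : δ = (ρ : ℝ) / (2 * τ)) :
    ∫ ε in Set.Iic (0:ℝ), ((1 + (β : ℝ) + (⌊2 * |ε + δ| / (m : ℝ)⌋ : ℝ)) *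
        ((-Real.log θ / 2) * θ ^ |ε|))
      = (1/2) * (1 + (β : ℝ)) +
        (1/2) * (θ ^ ((m : ℝ)/2) / (1 - θ ^ ((m : ℝ)/2))) * θ ^ δ := by
  obtain ⟨hθ0, hθ1⟩ := hθ
  obtain ⟨a, ha_def⟩ : ∃ a, a = -Real.log θ := ⟨_, rfl⟩
  have ha : 0 < a := by rw [ha_def]; exact neg_pos.2 (Real.log_neg hθ0 hθ1)
  have h_pow (x : ℝ) : θ ^ x = Real.exp (-a * x) := by
    rw [Real.rpow_def_of_pos hθ0, ha_def, neg_neg]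
  have hm1 : (1 : ℝ) ≤ m := by rw [hm]; exact_mod_cast Nat.one_le_two_pow
  have hc : (0 : ℝ) < m / 2 := by positivity
  have hδ0 : 0 ≤ δ := by rw [hδ]; positivity
  have hδc : δ ≤ m / 2 := by
    have hτ' : (0 : ℝ) < τ := by exact_mod_cast hτ
    have hρτ' : (ρ : ℝ) ≤ τ := by exact_mod_cast hρτ
    have : δ ≤ 1 / 2 := by rw [hδ, div_le_div_iff₀ (by positivity) two_pos]; linarith
    linarith
  have h_flip := integral_comp_neg_Iic 0 fun t : ℝ =>
    (1 + (β : ℝ) + (⌊2 * |-t + δ| / (m : ℝ)⌋ : ℝ)) * ((-Real.log θ / 2) * θ ^ |-t|)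
  simp only [neg_neg, neg_zero] at h_flip
  rw [h_flip]
  have h_split : ∫ t in Set.Ioi (0:ℝ), (1 + (β : ℝ) + (⌊2 * |-t + δ| / (m : ℝ)⌋ : ℝ)) *
        ((-Real.log θ / 2) * θ ^ |-t|)
      = ∫ t in Set.Ioi (0:ℝ), (((1 + (β : ℝ)) * (a / 2)) * Real.exp (-a * t) +
        (a / 2) * ((⌊|t - δ| / ((m : ℝ) / 2)⌋ : ℝ) * Real.exp (-a * t))) := by
    refine setIntegral_congr_fun measurableSet_Ioi fun t ht => ?_
    have h_arg : 2 * |-t + δ| / (m : ℝ) = |t - δ| / ((m : ℝ) / 2) := by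
      rw [abs_sub_comm, neg_add_eq_sub]; field_simp
    simp only [h_arg, h_pow, ← ha_def, abs_neg, abs_of_pos (Set.mem_Ioi.1 ht)]
    ring
  rw [h_split, integral_add
      ((integrableOn_exp_mul_Ioi (neg_lt_zero.2 ha) 0).const_mul _)
      ((integrableOn_floor_abs_sub_mul_exp ha hc δ).const_mul _),
    integral_const_mul, integral_const_mul, integral_exp_mul_Ioi (neg_lt_zero.2 ha),
    setIntegral_floor_abs_sub_mul_exp ha hc hδ0 hδc, h_pow, h_pow, mul_zero, Real.exp_zero,
    neg_div_neg_eq]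
  field_simp
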